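/- Suppose M is unmixed with dim M = 3 and depth M = 2, and M is not generalized Cohen-Macaulay. Let S be an S_2-ification of M and set D = S/M. Let x ∈ m be a parameter element of M such that D/xD has finite length and x·H^2_m(S) = 0. Then H^2_m(M)/x·H^2_m(M) ≅ H^2_m(S). -/

import Mathlib

open IsLocalRing

universe u

namespace Paper

variable (R : Type u) [CommRing R]

/-- `dim_{R/I} Soc_I(N)` where `Soc_I(N) = (0 :_N I)`. -/
noncomputable def socDim (I : Ideal R) (N : Type u) [AddCommGroup N] [Module R N] : ℕ :=
  Module.finrank (R ⧸ I) (Submodule.torsionBySet R N (I : Set R))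

/-- Krull dimension of a module (`⊥` for the zero module). -/
noncomputable def mdim (M : Type u) [AddCommGroup M] [Module R M] : WithBot (WithTop ℕ) :=
  ringKrullDim (R ⧸ Module.annihilator R M)

/-- The index of reducibility of an ideal `q` on `M`: `dim_k Soc (M/qM)`. -/
noncomputable def ir [IsLocalRing R] (M : Type u) [AddCommGroup M] [Module R M]
    (q : Ideal R) : ℕ :=
  socDim R (maximalIdeal R) (M ⧸ (q • ⊤ : Submodule R M))

/-- `dim_k Soc (H^i_m(M))`. -/
noncomputable def socH [IsLocalRing R] (M : Type u) [AddCommGroup M] [Module R M] (i : ℕ) : ℕ :=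
  socDim R (maximalIdeal R) ((localCohomology (maximalIdeal R) i).obj (ModuleCat.of R M))

/-- A system of parameters of `M` (of length `d`): `d` elements of the maximal ideal such
that the quotient has finite length. -/
def IsSOP [IsLocalRing R] (M : Type u) [AddCommGroup M] [Module R M] (d : ℕ)
    (x : Fin d → R) : Prop :=
  (∀ i, x i ∈ maximalIdeal R) ∧
    IsFiniteLength R (M ⧸ (Ideal.span (Set.range x) • ⊤ : Submodule R M))

/-- A parameter element: an element occurring in some system of parameters of `M`. -/
def IsParamElement [IsLocalRing R] (M : Type u) [AddCommGroup M] [Module R M] (d : ℕ)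
    (a : R) : Prop :=
  ∃ x : Fin d → R, IsSOP R M d x ∧ ∃ i, x i = a

/-- The ideal `b(M) = ⋂ Ann (0 :_{M/(x_1,...,x_{i-1})M} x_i)`, the intersection running over
all systems of parameters `x_1, ..., x_d` of `M`. -/
noncomputable def bIdeal [IsLocalRing R] (M : Type u) [AddCommGroup M] [Module R M]
    (d : ℕ) : Ideal R :=
  ⨅ (x : Fin d → R) (_ : IsSOP R M d x) (i : Fin d),
    Module.annihilator R
      (Submodule.torsionBy R (M ⧸ (Ideal.span (x '' {j | j < i}) • ⊤ : Submodule R M)) (x i))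

/-- A C-system of parameters: `x_i ∈ b(M/(x_{i+1},...,x_d)M)^3` for all `i`. -/
def IsCSOP [IsLocalRing R] (M : Type u) [AddCommGroup M] [Module R M] (d : ℕ)
    (x : Fin d → R) : Prop :=
  IsSOP R M d x ∧ ∀ i : Fin d,
    x i ∈ (bIdeal R (M ⧸ (Ideal.span (x '' {j | i < j}) • ⊤ : Submodule R M)) ((i : ℕ) + 1)) ^ 3

/-- The depth of `M`: the supremum of the lengths of `M`-regular sequences contained in the
maximal ideal. -/
noncomputable def depth [IsLocalRing R] (M : Type u) [AddCommGroup M] [Module R M] :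
    WithTop ℕ :=
  sSup {n : WithTop ℕ | ∃ rs : List R, (rs.length : WithTop ℕ) = n ∧
    (∀ r ∈ rs, r ∈ maximalIdeal R) ∧ RingTheory.Sequence.IsRegular M rs}

/-- `M` is a Cohen-Macaulay module: `depth M = dim M`. -/
def IsCM [IsLocalRing R] (M : Type u) [AddCommGroup M] [Module R M] : Prop :=
  (depth R M : WithBot (WithTop ℕ)) = mdim R M

/-- A Cohen-Macaulay local ring. -/
def IsCMLocalRing (S : Type u) [CommRing S] [IsLocalRing S] : Prop :=
  IsNoetherianRing S ∧ IsCM S S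

/-- `R` is a homomorphic image of a Cohen-Macaulay (Noetherian) local ring. -/
def IsQuotientOfCMLocalRing : Prop :=
  ∃ (S : Type u) (_ : CommRing S) (_ : IsLocalRing S),
    IsCMLocalRing S ∧ ∃ f : S →+* R, Function.Surjective f

/-- The largest submodule of (the submodule) `N` whose dimension is strictly smaller than
that of `N`. -/
noncomputable def uComp (M : Type u) [AddCommGroup M] [Module R M] (N : Submodule R M) :
    Submodule R M :=
  sSup {P : Submodule R M | P ≤ N ∧ mdim R P < mdim R N}

/-- The unmixed component `U_M(0)` of `M`: the largest submodule of dimension `< dim M`. -/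
noncomputable def unmixedComp (M : Type u) [AddCommGroup M] [Module R M] : Submodule R M :=
  uComp R M ⊤

/-- The 0-th local cohomology `H^0_m(M)` realized as the submodule of elements annihilated by
some power of the maximal ideal. -/
def H0sub [IsLocalRing R] (M : Type u) [AddCommGroup M] [Module R M] : Submodule R M :=
  ⨆ n : ℕ, Submodule.torsionBySet R M (((maximalIdeal R) ^ n : Ideal R) : Set R)

/-- The quotient `P/N` of two submodules of `M`. -/
abbrev subQuot (M : Type u) [AddCommGroup M] [Module R M] (P N : Submodule R M) :=
  P ⧸ (Submodule.comap P.subtype N)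

/-- `D_0 ⊆ D_1 ⊆ ⋯ ⊆ D_t = M` is the dimension filtration of `M`:
`D_t = M`, each `D_{i-1}` is the largest submodule of `D_i` of strictly smaller dimension,
and `D_0 = H^0_m(M)`. -/
def IsDimFiltration [IsLocalRing R] (M : Type u) [AddCommGroup M] [Module R M]
    (t : ℕ) (D : Fin (t + 1) → Submodule R M) : Prop :=
  D (Fin.last t) = ⊤ ∧ (∀ i : Fin t, D i.castSucc = uComp R M (D i.succ)) ∧
    D 0 = H0sub R M

/-- `M` is sequentially Cohen-Macaulay: all quotients `D_i/D_{i-1}` of the dimension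
filtration are Cohen-Macaulay. -/
def IsSeqCM [IsLocalRing R] (M : Type u) [AddCommGroup M] [Module R M] : Prop :=
  ∃ (t : ℕ) (D : Fin (t + 1) → Submodule R M), IsDimFiltration R M t D ∧
    ∀ i : Fin t, IsCM R (subQuot R M (D i.succ) (D i.castSucc))

/-- `M` (of dimension `d`) is generalized Cohen-Macaulay: `H^i_m(M)` has finite length
for all `i < d`. -/
def IsGenCM [IsLocalRing R] (M : Type u) [AddCommGroup M] [Module R M] (d : ℕ) : Prop :=
  ∀ i < d, IsFiniteLength R ((localCohomology (maximalIdeal R) i).obj (ModuleCat.of R M))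

/-- `α_n(M)`: the minimum of the indices of reducibility of parameter ideals of `M`
contained in `m^n`. -/
noncomputable def alphaN [IsLocalRing R] (M : Type u) [AddCommGroup M] [Module R M]
    (d n : ℕ) : ℕ :=
  sInf {r : ℕ | ∃ x : Fin d → R, IsSOP R M d x ∧
    Ideal.span (Set.range x) ≤ (maximalIdeal R) ^ n ∧ r = ir R M (Ideal.span (Set.range x))}

/-- The limit value `α(M) = lim_n α_n(M)` (the supremum of the non-decreasing sequence). -/
noncomputable def alphaLim [IsLocalRing R] (M : Type u) [AddCommGroup M] [Module R M]
    (d : ℕ) : ℕ :=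
  ⨆ n : ℕ, alphaN R M d (n + 1)

/-- `M` is unmixed: `dim R/p = dim M` for all associated primes `p`. -/
def IsUnmixed (M : Type u) [AddCommGroup M] [Module R M] : Prop :=
  ∀ p ∈ associatedPrimes R M, ringKrullDim (R ⧸ p) = mdim R M

/-- Serre's condition `(S_2)` for a module. -/
def IsS2 (L : Type u) [AddCommGroup L] [Module R L] : Prop :=
  ∀ p : PrimeSpectrum R, p ∈ Module.support R L →
    min 2 (mdim (Localization.AtPrime p.asIdeal) (LocalizedModule p.asIdeal.primeCompl L)) ≤
      (depth (Localization.AtPrime p.asIdeal) (LocalizedModule p.asIdeal.primeCompl L) :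
        WithBot (WithTop ℕ))

/-- `ι : M →ₗ[R] S` exhibits `S` as an `S_2`-ification of `M`. -/
def IsS2ification [IsLocalRing R] (M S : Type u) [AddCommGroup M] [Module R M]
    [AddCommGroup S] [Module R S] (ι : M →ₗ[R] S) : Prop :=
  Function.Injective ι ∧ Module.Finite R S ∧ IsS2 R S ∧
    ∀ (p : Ideal R) [p.IsPrime], p ≠ maximalIdeal R →
      IsS2 (Localization.AtPrime p) (LocalizedModule p.primeCompl M) →
      Function.Surjective (IsLocalizedModule.map p.primeCompl
        (LocalizedModule.mkLinearMap p.primeCompl M)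
        (LocalizedModule.mkLinearMap p.primeCompl S) ι)

end Paper

noncomputable section
open CategoryTheory Limits Opposite
namespace LC
variable {R : Type u} [CommRing R]

abbrev Kop {X : ModuleCat.{u} R} (P : ProjectiveResolution X) (N : ModuleCat.{u} R) :
    ChainComplex (ModuleCat.{u} R)ᵒᵖ ℕ :=
  (((linearYoneda R (ModuleCat.{u} R)).obj N).rightOp.mapHomologicalComplex _).obj P.complex

def isoH {X : ModuleCat.{u} R} (P : ProjectiveResolution X) (N : ModuleCat.{u} R) (i : ℕ) :
    (((linearYoneda R (ModuleCat.{u} R)).obj N).rightOp.leftDerived i).obj X ≅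
      (Kop P N).homology i :=
  P.isoLeftDerivedObj ((linearYoneda R (ModuleCat.{u} R)).obj N).rightOp i

/-- map from cocycles to Ext. -/
def qmap {X : ModuleCat.{u} R} (P : ProjectiveResolution X) (N : ModuleCat.{u} R) (i : ℕ) :
    ((Kop P N).opcycles i).unop ⟶ ((Ext R (ModuleCat.{u} R) i).obj (op X)).obj N :=
  ((isoH P N i).hom ≫
    (Kop P N).homologyι i).unop

def jmap {X : ModuleCat.{u} R} (P : ProjectiveResolution X) (N : ModuleCat.{u} R) (i : ℕ) :
    ((Kop P N).opcycles i).unop ⟶ ModuleCat.of R (P.complex.X i ⟶ N) :=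
  ((Kop P N).pOpcycles i).unop

def Rep {X : ModuleCat.{u} R} (P : ProjectiveResolution X) (N : ModuleCat.{u} R) (i : ℕ)
    (f : P.complex.X i ⟶ N) (e : ((Ext R (ModuleCat.{u} R) i).obj (op X)).obj N) : Prop :=
  ∃ z, jmap P N i z = f ∧ qmap P N i z = e

variable {X : ModuleCat.{u} R} {P : ProjectiveResolution X} {N : ModuleCat.{u} R} {i : ℕ}

instance : Mono (jmap P N i) := by unfold jmap; exact unop_mono_of_epi _

lemma Rep.exists_rep (P : ProjectiveResolution X) (e : ((Ext R (ModuleCat.{u} R) i).obj (op X)).obj N) : ∃ f, Rep P N i f e := by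
  have h1 := (ModuleCat.epi_iff_surjective (isoH P N i).hom.unop).1 inferInstance
  have h2 := (ModuleCat.epi_iff_surjective ((Kop P N).homologyι i).unop).1 inferInstance
  obtain ⟨z, hz⟩ := (h1.comp h2) e
  exact ⟨_, z, rfl, hz⟩

lemma Rep.unique {f} {e e'} (h : Rep P N i f e) (h' : Rep P N i f e') : e = e' := by
  obtain ⟨z, hz, rfl⟩ := h
  obtain ⟨z', hz', rfl⟩ := h'
  have := (ModuleCat.mono_iff_injective (jmap P N i)).1 inferInstance (hz.trans hz'.symm)
  rw [this]

lemma Rep.add {f f'} {e e'} (h : Rep P N i f e) (h' : Rep P N i f' e') :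
    Rep P N i (f + f') (e + e') := by
  obtain ⟨z, rfl, rfl⟩ := h
  obtain ⟨z', rfl, rfl⟩ := h'
  exact ⟨z + z', by rw [map_add], by rw [map_add]⟩

lemma Rep.smul {f} {e} (r : R) (h : Rep P N i f e)  :
    Rep P N i (r • f) (r • e) := by
  obtain ⟨z, rfl, rfl⟩ := h
  exact ⟨r • z, by rw [map_smul], by rw [map_smul]⟩

lemma Rep.zero : Rep P N i 0 0 := ⟨0, by rw [map_zero], by rw [map_zero]⟩

lemma Rep.cocycle {f} {e} (h : Rep P N i f e) : P.complex.d (i+1) i ≫ f = 0 := by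
  obtain ⟨z, rfl, rfl⟩ := h
  have := congrArg (fun k => k.unop) ((Kop P N).d_pOpcycles (i+1) i)
  exact congrArg (fun k => k.hom z) this

lemma Rep.of_cocycle {f : P.complex.X i ⟶ N} (h : P.complex.d (i+1) i ≫ f = 0) :
    ∃ e, Rep P N i f e := by
  let fm : ModuleCat.of R R ⟶ ModuleCat.of R (P.complex.X i ⟶ N) :=
    ModuleCat.ofHom (LinearMap.toSpanSingleton R _ f)
  have hf : (Kop P N).d (i+1) i ≫ (show (Kop P N).X i ⟶ op (ModuleCat.of R R) from fm.op) = 0 := by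
    apply Quiver.Hom.unop_inj
    ext
    have : P.complex.d (i+1) i ≫ ((1:R) • f) = 0 := by rw [one_smul, h]
    exact this
  refine ⟨_, ((Kop P N).descOpcycles (show (Kop P N).X i ⟶ op (ModuleCat.of R R) from fm.op) (i+1) (by simp) hf).unop (1 : R), ?_, rfl⟩
  have := congrArg (fun k => k.unop) ((Kop P N).p_descOpcycles (show (Kop P N).X i ⟶ op (ModuleCat.of R R) from fm.op) (i+1) (by simp) hf)
  refine (congrArg (fun k => k.hom (1 : R)) this).trans ?_
  exact one_smul R f

lemma Rep.coboundary (g : P.complex.X i ⟶ N) : Rep P N (i+1) (P.complex.d (i+1) i ≫ g) 0 := by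
  refine ⟨((Kop P N).fromOpcycles (i+1) i).unop (show ModuleCat.of R (P.complex.X i ⟶ N) from g), ?_, ?_⟩
  · have := congrArg (fun k => k.unop) ((Kop P N).p_fromOpcycles (i+1) i)
    exact congrArg (fun k => k.hom g) this
  · have := congrArg (fun k => k.unop) ((Kop P N).homologyι_comp_fromOpcycles (i+1) i)
    have h2 := congrArg (fun k => k.hom g) this
    have h3 : ∀ z, qmap P N (i+1) z = (isoH P N (i+1)).hom.unop (((Kop P N).homologyι (i+1)).unop z) := fun z => rfl
    rw [h3]
    erw [h2]
    exact map_zero _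

lemma Rep.of_zero {f} (h : Rep P N (i+1) f 0) : ∃ g, f = P.complex.d (i+1) i ≫ g := by
  obtain ⟨z, rfl, hz⟩ := h
  have ex : (ShortComplex.mk _ _ ((Kop P N).homologyι_comp_fromOpcycles (i+1) i)).Exact :=
    ShortComplex.exact_of_f_is_kernel _ ((Kop P N).homologyIsKernel (i+1) i (by simp))
  have ex2 := (ShortComplex.moduleCat_exact_iff _).1 ex.unop
  have h3 : (isoH P N (i+1)).hom.unop (((Kop P N).homologyι (i+1)).unop z) = 0 := hz
  have h4 : ((Kop P N).homologyι (i+1)).unop z = 0 := by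
    apply (ModuleCat.mono_iff_injective (isoH P N (i+1)).hom.unop).1 inferInstance
    rw [h3]; exact (map_zero _).symm
  obtain ⟨g, hg⟩ := ex2 z h4
  refine ⟨g, ?_⟩
  rw [← hg]
  have := congrArg (fun k => k.unop) ((Kop P N).p_fromOpcycles (i+1) i)
  exact congrArg (fun k => k.hom g) this

lemma Rep.mapN {N' : ModuleCat.{u} R} (φ : N ⟶ N') {f} {e} (h : Rep P N i f e) :
    Rep P N' i (f ≫ φ) (((Ext R (ModuleCat.{u} R) i).obj (op X)).map φ e) := by
  obtain ⟨z, rfl, rfl⟩ := h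
  let α : ((linearYoneda R (ModuleCat.{u} R)).obj N').rightOp ⟶
    ((linearYoneda R (ModuleCat.{u} R)).obj N).rightOp := NatTrans.rightOp ((linearYoneda R (ModuleCat.{u} R)).map φ)
  let κ : Kop P N' ⟶ Kop P N := (NatTrans.mapHomologicalComplex α _).app P.complex
  refine ⟨(HomologicalComplex.opcyclesMap κ i).unop z, ?_, ?_⟩
  · have := congrArg (fun k => k.unop) (HomologicalComplex.p_opcyclesMap κ i)
    exact congrArg (fun k => k.hom z) this
  · have h1 : (NatTrans.leftDerived α i).app X = (isoH P N' i).hom ≫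
        HomologicalComplex.homologyMap κ i ≫ (isoH P N i).inv :=
      ProjectiveResolution.leftDerived_app_eq α P i
    have h2 : (NatTrans.leftDerived α i).app X ≫ (isoH P N i).hom ≫ (Kop P N).homologyι i
       = ((isoH P N' i).hom ≫ (Kop P N').homologyι i) ≫ HomologicalComplex.opcyclesMap κ i := by
      rw [h1]
      simp only [Category.assoc, Iso.inv_hom_id_assoc]
      rw [← HomologicalComplex.homologyι_naturality]
    have h3 := congrArg (fun k => k.unop) h2
    exact (congrArg (fun k => k.hom z) h3).symm

lemma Rep.mapX {X' : ModuleCat.{u} R} (w : X' ⟶ X) {P' : ProjectiveResolution X'}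
    (U : P'.complex ⟶ P.complex) (comm : U.f 0 ≫ P.π.f 0 = P'.π.f 0 ≫ w)
    {f} {e} (h : Rep P N i f e) :
    Rep P' N i (U.f i ≫ f) (((Ext R (ModuleCat.{u} R) i).map w.op).app N e) := by
  obtain ⟨z, rfl, rfl⟩ := h
  let F := ((linearYoneda R (ModuleCat.{u} R)).obj N).rightOp
  let κ : Kop P' N ⟶ Kop P N := (F.mapHomologicalComplex _).map U
  refine ⟨(HomologicalComplex.opcyclesMap κ i).unop z, ?_, ?_⟩
  · have := congrArg (fun k => k.unop) (HomologicalComplex.p_opcyclesMap κ i)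
    exact congrArg (fun k => k.hom z) this
  · have h1 : (F.leftDerived i).map w ≫ (isoH P N i).hom =
        (isoH P' N i).hom ≫ HomologicalComplex.homologyMap κ i :=
      ProjectiveResolution.isoLeftDerivedObj_hom_naturality w P' P U comm F i
    have h2 : (F.leftDerived i).map w ≫ (isoH P N i).hom ≫ (Kop P N).homologyι i
       = ((isoH P' N i).hom ≫ (Kop P' N).homologyι i) ≫ HomologicalComplex.opcyclesMap κ i := by
      rw [reassoc_of% h1, Category.assoc, ← HomologicalComplex.homologyι_naturality]
    have h3 := congrArg (fun k => k.unop) h2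
    exact (congrArg (fun k => k.hom z) h3).symm

open localCohomology

/-- the canonical map from Ext to local cohomology -/
def toH (J : Ideal R) (i t : ℕ) (N : ModuleCat.{u} R) :
    ((Ext R (ModuleCat.{u} R) i).obj (op (ModuleCat.of R (R ⧸ J ^ t)))).obj N ⟶
      (localCohomology J i).obj N :=
  (colimit.ι (diagram (idealPowersDiagram J) i) (op (op t))).app N

def trans (J : Ideal R) {t t' : ℕ} (h : t ≤ t') :
    ModuleCat.of R (R ⧸ J ^ t') ⟶ ModuleCat.of R (R ⧸ J ^ t) :=
  ModuleCat.ofHom (Submodule.mapQ _ _ LinearMap.id (Ideal.pow_le_pow_right h))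

lemma toH_trans (J : Ideal R) (i : ℕ) {t t' : ℕ} (h : t ≤ t') (N : ModuleCat.{u} R) (e) :
    toH J i t' N (((Ext R (ModuleCat.{u} R) i).map (trans J h).op).app N e) = toH J i t N e := by
  have := colimit.w (diagram (idealPowersDiagram J) i) (homOfLE h).op.op
  have h2 := congrArg (fun k => (k.app N).hom e) this
  exact h2

lemma toH_natural (J : Ideal R) (i t : ℕ) {N N' : ModuleCat.{u} R} (φ : N ⟶ N') (e) :
    toH J i t N' (((Ext R (ModuleCat.{u} R) i).obj (op (ModuleCat.of R (R ⧸ J ^ t)))).map φ e) =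
      (localCohomology J i).map φ (toH J i t N e) := by
  have := (colimit.ι (diagram (idealPowersDiagram J) i) (op (op t))).naturality φ
  exact congrArg (fun k => k.hom e) this

instance instPF : PreservesFilteredColimitsOfSize.{0, 0} (forget (ModuleCat.{u} R)) :=
  preservesFilteredColimitsOfSize_shrink.{0, u, 0, u} _

instance : IsFiltered (ℕᵒᵖᵒᵖ) := inferInstance

instance instPC : PreservesColimitsOfShape (ℕᵒᵖᵒᵖ) (forget (ModuleCat.{u} R)) :=
  PreservesFilteredColimitsOfSize.preserves_filtered_colimits _

def isCol (J : Ideal R) (i : ℕ) (N : ModuleCat.{u} R) :=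
  isColimitOfPreserves ((evaluation _ _).obj N) (colimit.isColimit (diagram (idealPowersDiagram J) i))

lemma toH_exists (J : Ideal R) (i : ℕ) (N : ModuleCat.{u} R) (h : (localCohomology J i).obj N) :
    ∃ t e, toH J i t N e = h := by
  obtain ⟨t, e, he⟩ := Concrete.isColimit_exists_rep _ (isCol J i N) h
  exact ⟨t.unop.unop, e, he⟩

lemma toH_eq_zero (J : Ideal R) (i t : ℕ) (N : ModuleCat.{u} R) (e) (h0 : toH J i t N e = 0) :
    ∃ t', ∃ h : t ≤ t', ((Ext R (ModuleCat.{u} R) i).map (trans J h).op).app N e = 0 := by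
  have h00 : toH J i t N e = toH J i t N 0 := by rw [h0, map_zero]
  obtain ⟨t', f, g, he⟩ := Concrete.isColimit_exists_of_rep_eq _ (isCol J i N) _ _ h00
  refine ⟨t'.unop.unop, leOfHom f.unop.unop, ?_⟩
  refine Eq.trans ?_ (he.trans (map_zero _))
  rfl

/-- chosen resolutions -/
def Res (J : Ideal R) (t : ℕ) : ProjectiveResolution (ModuleCat.of R (R ⧸ J ^ t)) :=
  ProjectiveResolution.of _

def Rel (J : Ideal R) (i t : ℕ) (N : ModuleCat.{u} R) (f : (Res J t).complex.X i ⟶ N)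
    (h : (localCohomology J i).obj N) : Prop :=
  ∃ e, Rep (Res J t) N i f e ∧ toH J i t N e = h

variable {J : Ideal R} {t : ℕ}

lemma Rel.exists_rel (h : (localCohomology J i).obj N) : ∃ t f, Rel J i t N f h := by
  obtain ⟨t, e, he⟩ := toH_exists J i N h
  obtain ⟨f, hf⟩ := Rep.exists_rep (Res J t) e
  exact ⟨t, f, e, hf, he⟩

lemma Rel.of_cocycle {f : (Res J t).complex.X i ⟶ N} (h : (Res J t).complex.d (i+1) i ≫ f = 0) :
    ∃ h, Rel J i t N f h := by
  obtain ⟨e, he⟩ := Rep.of_cocycle h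
  exact ⟨_, e, he, rfl⟩

lemma Rel.cocycle {f} {h} (H : Rel J i t N f h) : (Res J t).complex.d (i+1) i ≫ f = 0 := by
  obtain ⟨e, he, _⟩ := H
  exact he.cocycle

lemma Rel.unique {f} {h h'} (H : Rel J i t N f h) (H' : Rel J i t N f h') : h = h' := by
  obtain ⟨e, he, rfl⟩ := H
  obtain ⟨e', he', rfl⟩ := H'
  rw [he.unique he']

lemma Rel.add {f f'} {h h'} (H : Rel J i t N f h) (H' : Rel J i t N f' h') :
    Rel J i t N (f + f') (h + h') := by
  obtain ⟨e, he, rfl⟩ := H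
  obtain ⟨e', he', rfl⟩ := H'
  exact ⟨_, he.add he', map_add _ _ _⟩

lemma Rel.smul {f} {h} (r : R) (H : Rel J i t N f h) :
    Rel J i t N (r • f) (r • h) := by
  obtain ⟨e, he, rfl⟩ := H
  exact ⟨_, he.smul r, map_smul _ _ _⟩

lemma Rel.zero : Rel J i t N 0 0 := ⟨0, Rep.zero, map_zero _⟩

lemma Rel.coboundary (g : (Res J t).complex.X i ⟶ N) :
    Rel J (i+1) t N ((Res J t).complex.d (i+1) i ≫ g) 0 :=
  ⟨0, Rep.coboundary g, map_zero _⟩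

lemma Rel.mapN {N' : ModuleCat.{u} R} (φ : N ⟶ N') {f} {h} (H : Rel J i t N f h) :
    Rel J i t N' (f ≫ φ) ((localCohomology J i).map φ h) := by
  obtain ⟨e, he, rfl⟩ := H
  exact ⟨_, he.mapN φ, toH_natural _ _ _ _ _⟩

lemma Rel.mapX {t' : ℕ} (ht : t ≤ t') (U : (Res J t').complex ⟶ (Res J t).complex)
    (comm : U.f 0 ≫ (Res J t).π.f 0 = (Res J t').π.f 0 ≫ trans J ht)
    {f} {h} (H : Rel J i t N f h) : Rel J i t' N (U.f i ≫ f) h := by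
  obtain ⟨e, he, rfl⟩ := H
  exact ⟨_, he.mapX _ U comm, toH_trans _ _ _ _ _⟩

/-- the canonical comparison chain map -/
def lft (J : Ideal R) {t t' : ℕ} (ht : t ≤ t') : (Res J t').complex ⟶ (Res J t).complex :=
  ProjectiveResolution.lift (trans J ht) _ _

lemma Rel.lft {t' : ℕ} (ht : t ≤ t') {f} {h} (H : Rel J i t N f h) :
    Rel J i t' N ((lft J ht).f i ≫ f) h :=
  H.mapX ht _ (ProjectiveResolution.lift_commutes_zero _ _ _)

lemma Rel.of_zero {f} (H : Rel J (i+1) t N f 0) : ∃ t', ∃ ht : t ≤ t', ∃ g,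
    (LC.lft J ht).f (i+1) ≫ f = (Res J t').complex.d (i+1) i ≫ g := by
  obtain ⟨e, he, h0⟩ := H
  obtain ⟨t', ht, h1⟩ := toH_eq_zero _ _ _ _ _ h0
  have := he.mapX _ (LC.lft J ht) (ProjectiveResolution.lift_commutes_zero _ _ _)
  rw [h1] at this
  exact ⟨t', ht, this.of_zero⟩

/-- multiplication acts as expected. -/
lemma map_lsmul (a : R) (h : (localCohomology J i).obj N) :
    (localCohomology J i).map (ModuleCat.ofHom (LinearMap.lsmul R N a)) h = a • h := by
  obtain ⟨t, f, H⟩ := Rel.exists_rel h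
  refine Rel.unique (H.mapN _) ?_
  have : f ≫ ModuleCat.ofHom (LinearMap.lsmul R N a) = a • f := by
    ext x; rfl
  rw [this]
  exact H.smul a

lemma torsion (a : R) (ha : a ∈ J) (h : (localCohomology J i).obj N) : ∃ t : ℕ, a ^ t • h = 0 := by
  obtain ⟨t, f, e, he, rfl⟩ := Rel.exists_rel h
  refine ⟨t, ?_⟩
  have h1 := he.mapX (P' := Res J t) 0 0 (by
    rw [HomologicalComplex.zero_f]; exact zero_comp.trans comp_zero.symm)
  have h2 := he.mapX (P' := Res J t) 0 (a ^ t • 𝟙 _) (by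
    have : ∀ y : (ModuleCat.of R (R ⧸ J ^ t)), a ^ t • y = 0 := by
      intro y
      obtain ⟨y, rfl⟩ := Submodule.Quotient.mk_surjective _ y
      rw [← Submodule.Quotient.mk_smul, Submodule.Quotient.mk_eq_zero]
      exact Ideal.mul_mem_right _ _ (Ideal.pow_mem_pow ha t)
    ext x
    refine (map_smul ((Res J t).π.f 0).hom (a ^ t) x).trans ?_
    exact this _)
  have h3 : (0 : (Res J t).complex ⟶ (Res J t).complex).f i ≫ f = 0 := by simp
  have h4 : (a ^ t • 𝟙 (Res J t).complex : (Res J t).complex ⟶ (Res J t).complex).f i ≫ f = a ^ t • f := by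
    simp
  rw [h3] at h1
  rw [h4] at h2
  have h5 := h1.unique Rep.zero
  have h6 := h2.unique (he.smul (a ^ t))
  rw [← map_smul, ← h6, h5, map_zero]

lemma Rel.sub {f f'} {h h'} (H : Rel J i t N f h) (H' : Rel J i t N f' h') :
    Rel J i t N (f - f') (h - h') := by
  have := H.add (H'.smul (-1))
  simpa [sub_eq_add_neg] using this

section LES
variable {T : ShortComplex (ModuleCat.{u} R)}

lemma liftC (hT : T.ShortExact) (k : (Res J t).complex.X i ⟶ T.X₃) : ∃ k', k' ≫ T.g = k := by
  have := hT.epi_g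
  exact ⟨Projective.factorThru k T.g, Projective.factorThru_comp _ _⟩

lemma liftA (hT : T.ShortExact) {X : ModuleCat.{u} R} (k : X ⟶ T.X₂) (hk : k ≫ T.g = 0) : ∃ k', k' ≫ T.f = k := by
  have := hT.mono_f
  exact ⟨hT.exact.lift k hk, hT.exact.lift_f k hk⟩

lemma cancelA (hT : T.ShortExact) {X : ModuleCat.{u} R} {k k' : X ⟶ T.X₁} (h : k ≫ T.f = k' ≫ T.f) : k = k' := by
  have := hT.mono_f
  exact (cancel_mono T.f).1 h

lemma exact_mid (hT : T.ShortExact) (h : (localCohomology J (i+1)).obj T.X₂)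
    (h0 : (localCohomology J (i+1)).map T.g h = 0) :
    ∃ h', (localCohomology J (i+1)).map T.f h' = h := by
  obtain ⟨t, β, H⟩ := Rel.exists_rel h
  have H0 := H.mapN T.g
  rw [h0] at H0
  obtain ⟨t', ht, γ, hγ⟩ := H0.of_zero
  obtain ⟨γ', rfl⟩ := liftC hT γ
  have Hβ := (H.lft ht).sub (Rel.coboundary γ')
  rw [sub_zero] at Hβ
  obtain ⟨α, hα⟩ := liftA hT ((lft J ht).f (i+1) ≫ β - (Res J t').complex.d (i+1) i ≫ γ')
    (by simp [hγ])
  have hc : (Res J t').complex.d (i+1+1) (i+1) ≫ α = 0 := by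
    apply cancelA hT
    rw [Category.assoc, hα, Hβ.cocycle, zero_comp]
  obtain ⟨h', H'⟩ := Rel.of_cocycle hc
  refine ⟨h', Rel.unique (H'.mapN T.f) ?_⟩
  rwa [hα]

lemma surj_of_vanish (hT : T.ShortExact) (hv : ∀ h : (localCohomology J (i+1)).obj T.X₁, h = 0)
    (c : (localCohomology J i).obj T.X₃) :
    ∃ h', (localCohomology J i).map T.g h' = c := by
  obtain ⟨t, γ, H⟩ := Rel.exists_rel c
  obtain ⟨β, rfl⟩ := liftC hT γ
  have hc := H.cocycle
  rw [← Category.assoc] at hc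
  obtain ⟨α, hα⟩ := liftA hT _ hc
  have hc' : (Res J t).complex.d (i+1+1) (i+1) ≫ α = 0 := by
    apply cancelA hT
    rw [Category.assoc, hα, HomologicalComplex.d_comp_d_assoc, zero_comp, zero_comp]
  obtain ⟨h, H1⟩ := Rel.of_cocycle hc'
  rw [hv h] at H1
  obtain ⟨t', ht, α', hα'⟩ := H1.of_zero
  have h3 : (Res J t').complex.d (i+1) i ≫ ((lft J ht).f i ≫ β - α' ≫ T.f) = 0 := by
    rw [Preadditive.comp_sub, ← Category.assoc _ α', ← hα', Category.assoc _ α, hα]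
    simp
  obtain ⟨h', H'⟩ := Rel.of_cocycle h3
  refine ⟨h', Rel.unique (H'.mapN T.g) ?_⟩
  have := H.lft ht
  simpa using this

lemma ker_divisible (hT : T.ShortExact) (a : R) (hv : ∀ c : (localCohomology J (i+1)).obj T.X₃, ∃ c', c = a • c')
    (h : (localCohomology J (i+1+1)).obj T.X₁)
    (h0 : (localCohomology J (i+1+1)).map T.f h = 0) : ∃ h', h = a • h' := by
  obtain ⟨t, α, H⟩ := Rel.exists_rel h
  have H0 := H.mapN T.f
  rw [h0] at H0
  obtain ⟨t', ht, β, hβ⟩ := H0.of_zero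
  have H := H.lft ht
  have hc : (Res J t').complex.d (i+1+1) (i+1) ≫ (β ≫ T.g) = 0 := by
    rw [← Category.assoc, ← hβ]; simp
  obtain ⟨c, Hc⟩ := Rel.of_cocycle hc
  obtain ⟨c', rfl⟩ := hv c
  obtain ⟨t2, γ, Hγ⟩ := Rel.exists_rel c'
  have H1 := ((Hc.lft (le_max_left t' t2)).sub ((Hγ.lft (le_max_right t' t2)).smul a))
  rw [sub_self] at H1
  obtain ⟨s, hs, v, hv⟩ := H1.of_zero
  have H := (H.lft (le_max_left t' t2)).lft hs
  have Hγ := (Hγ.lft (le_max_right t' t2)).lft hs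
  set α1 := (lft J hs).f (i + 1 + 1) ≫ (lft J (le_max_left t' t2)).f (i + 1 + 1) ≫
    (lft J ht).f (i + 1 + 1) ≫ α with hα1
  set β1 := (lft J hs).f (i + 1) ≫ (lft J (le_max_left t' t2)).f (i + 1) ≫ β with hβ1
  set γ1 := (lft J hs).f (i + 1) ≫ (lft J (le_max_right t' t2)).f (i + 1) ≫ γ with hγ1
  have e1 : α1 ≫ T.f = (Res J s).complex.d _ _ ≫ β1 := by
    simp only [hα1, hβ1, Category.assoc]
    rw [hβ]
    simp
  have e2 : β1 ≫ T.g = a • γ1 + (Res J s).complex.d _ _ ≫ v := by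
    rw [← hv]
    simp [hγ1, hβ1]
  clear_value α1 β1 γ1
  obtain ⟨γ', rfl⟩ := liftC hT γ1
  obtain ⟨v', rfl⟩ := liftC hT v
  obtain ⟨k, hk⟩ := liftA hT (β1 - a • γ' - (Res J s).complex.d _ _ ≫ v') (by simp [e2])
  have hc2 := Hγ.cocycle
  rw [← Category.assoc] at hc2
  obtain ⟨w, hw⟩ := liftA hT _ hc2
  have hc3 : (Res J s).complex.d (i+1+1+1) (i+1+1) ≫ w = 0 := by
    apply cancelA hT
    rw [Category.assoc, hw, HomologicalComplex.d_comp_d_assoc, zero_comp, zero_comp]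
  obtain ⟨h', H'⟩ := Rel.of_cocycle hc3
  refine ⟨h', ?_⟩
  have H2 := (H'.smul a).add (Rel.coboundary k)
  rw [add_zero] at H2
  refine Rel.unique H ?_
  have : α1 = a • w + (Res J s).complex.d (i+1+1) (i+1) ≫ k := by
    apply cancelA hT
    rw [e1, Preadditive.add_comp, Linear.smul_comp, Category.assoc, hw, hk]
    simp
  rwa [this]

lemma inj_of_vanish (hT : T.ShortExact) (hv : ∀ c : (localCohomology J (i+1)).obj T.X₃, c = 0)
    (h : (localCohomology J (i+1+1)).obj T.X₁)
    (h0 : (localCohomology J (i+1+1)).map T.f h = 0) : h = 0 := by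
  obtain ⟨h', rfl⟩ := ker_divisible hT 0 (fun c => ⟨0, by rw [hv c, smul_zero]⟩) h h0
  exact zero_smul _ _
end LES

lemma key [IsNoetherianRing R] (J : Ideal R) (t : ℕ) :
    ∃ (r : ℕ) (α : (Fin r → R) →ₗ[R] (Res J t).complex.X 1), ∀ n : ℕ,
      ∃ U : (Res J (t+n)).complex ⟶ (Res J t).complex,
        U.f 0 ≫ (Res J t).π.f 0 = (Res J (t+n)).π.f 0 ≫ trans J (Nat.le_add_right t n) ∧
        ∀ y, ∃ w ∈ (J ^ n • ⊤ : Submodule R (Fin r → R)), U.f 1 y = α w := by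
  obtain ⟨p0, hp0⟩ := (ModuleCat.epi_iff_surjective ((Res J t).π.f 0)).1 inferInstance
    (Submodule.Quotient.mk (p := J ^ t) (1 : R))
  obtain ⟨r, g, hg⟩ := Submodule.fg_iff_exists_fin_generating_family.1
    (IsNoetherian.noetherian (J ^ t))
  have hρ : ∀ s : R, (Res J t).π.f 0 (s • p0) = Submodule.Quotient.mk (p := J ^ t) s := by
    intro s
    refine (map_smul ((Res J t).π.f 0).hom s p0).trans ?_
    refine (congrArg (fun z => s • z) hp0).trans ?_
    refine (Submodule.Quotient.mk_smul (J ^ t) s (1:R)).symm.trans ?_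
    rw [smul_eq_mul, mul_one]
  have hb : ∀ j, ∃ b : (Res J t).complex.X 1, (Res J t).complex.d 1 0 b = g j • p0 := by
    intro j
    have ex := (ShortComplex.moduleCat_exact_iff _).1 (Res J t).exact₀ (g j • p0)
    apply ex
    refine (hρ (g j)).trans ?_
    exact (Submodule.Quotient.mk_eq_zero (J ^ t)).2
      (by rw [← hg]; exact Submodule.subset_span ⟨j, rfl⟩)
  choose b hb using hb
  let ε : (Fin r → R) →ₗ[R] R := Fintype.linearCombination R g
  let α : (Fin r → R) →ₗ[R] (Res J t).complex.X 1 := Fintype.linearCombination R b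
  have hε : LinearMap.range ε = J ^ t := by
    rw [← hg]; exact Fintype.range_linearCombination R g
  have hdα : ∀ w, (Res J t).complex.d 1 0 (α w) = ε w • p0 := by
    intro w
    simp only [α, ε, Fintype.linearCombination_apply, map_sum, map_smul, hb, Finset.sum_smul,
      smul_smul, smul_eq_mul]
  refine ⟨r, α, fun n => ?_⟩
  have pr0 : Module.Projective R ((Res J (t+n)).complex.X 0) :=
    (IsProjective.iff_projective _).2 ((Res J (t+n)).projective 0)
  have pr1 : Module.Projective R ((Res J (t+n)).complex.X 1) :=
    (IsProjective.iff_projective _).2 ((Res J (t+n)).projective 1)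
  let π' : (Res J (t+n)).complex.X 0 →ₗ[R] R ⧸ J ^ (t+n) := ((Res J (t+n)).π.f 0).hom
  obtain ⟨σ, hσ⟩ := Module.projective_lifting_property (Submodule.mkQ (J ^ (t+n))) π'
    (Submodule.mkQ_surjective _)
  let d' : (Res J (t+n)).complex.X 1 →ₗ[R] (Res J (t+n)).complex.X 0 :=
    ((Res J (t+n)).complex.d 1 0).hom
  have hd' : ∀ y, σ (d' y) ∈ J ^ (t+n) := by
    intro y
    rw [← Submodule.Quotient.mk_eq_zero]
    have h1 := congrArg (fun k => k (d' y)) hσ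
    refine h1.trans ?_
    exact congrArg (fun k => k.hom y) (Res J (t+n)).complex_d_comp_π_f_zero
  have hmap : Submodule.map ε (J ^ n • ⊤) = J ^ (t+n) := by
    rw [Submodule.map_smul'', Submodule.map_top, hε, smul_eq_mul, ← pow_add, add_comm]
  let ε' : (J ^ n • ⊤ : Submodule R (Fin r → R)) →ₗ[R] (J ^ (t+n) : Ideal R) :=
    (ε.domRestrict _).codRestrict _ (fun w => by
      rw [← hmap]; exact Submodule.mem_map_of_mem w.2)
  have hε' : Function.Surjective ε' := by
    rintro ⟨y, hy⟩
    have hy' := hy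
    rw [← hmap] at hy'
    obtain ⟨w, hw, rfl⟩ := hy'
    exact ⟨⟨w, hw⟩, rfl⟩
  obtain ⟨θ, hθ⟩ := Module.projective_lifting_property ε'
    (LinearMap.codRestrict (J ^ (t+n)) (σ ∘ₗ d') hd') hε'
  have hθ' : ∀ y, ε (θ y) = σ (d' y) := fun y => congrArg (fun k => (k y).1) hθ
  let U0 : (Res J (t+n)).complex.X 0 ⟶ (Res J t).complex.X 0 :=
    ModuleCat.ofHom (LinearMap.toSpanSingleton R _ p0 ∘ₗ σ)
  let U1 : (Res J (t+n)).complex.X 1 ⟶ (Res J t).complex.X 1 :=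
    ModuleCat.ofHom (α ∘ₗ Submodule.subtype _ ∘ₗ θ)
  have h01 : U1 ≫ (Res J t).complex.d 1 0 = (Res J (t+n)).complex.d 1 0 ≫ U0 := by
    ext y
    refine (hdα _).trans ?_
    exact congrArg (fun z => z • p0) (hθ' y)
  refine ⟨ChainComplex.mkHom _ _ U0 U1 h01 fun n ⟨g, g', w⟩ =>
      ⟨ProjectiveResolution.liftFSucc _ _ n g g' w |>.1,
       ProjectiveResolution.liftFSucc _ _ n g g' w |>.2⟩, ?_, ?_⟩
  · rw [ChainComplex.mkHom_f_0]
    ext y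
    refine (hρ (σ y)).trans ?_
    have h1 : Submodule.Quotient.mk (p := J ^ (t+n)) (σ y) = π' y := congrArg (fun k => k y) hσ
    refine Eq.trans ?_ (congrArg (trans J (Nat.le_add_right t n)).hom h1)
    rfl
  · intro y
    rw [ChainComplex.mkHom_f_1]
    exact ⟨θ y, (θ y).2, rfl⟩

lemma vanish1 [IsNoetherianRing R] (k : ℕ) (hN : ∀ r ∈ J ^ k, ∀ x : N, r • x = 0)
    (h : (localCohomology J 1).obj N) : h = 0 := by
  obtain ⟨t, f, H⟩ := Rel.exists_rel h
  obtain ⟨r, α, hα⟩ := key J t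
  obtain ⟨U, hU, hU1⟩ := hα k
  have H1 := H.mapX _ U hU
  have h0 : U.f 1 ≫ f = 0 := by
    ext y
    obtain ⟨w, hw, hwy⟩ := hU1 y
    refine (congrArg f.hom hwy).trans ?_
    have : (J ^ k • ⊤ : Submodule R (Fin r → R)) ≤ LinearMap.ker (f.hom ∘ₗ α) := by
      rw [Submodule.smul_le]
      intro s hs x _
      rw [LinearMap.mem_ker, map_smul]
      exact hN s hs _
    exact this hw
  rw [h0] at H1
  exact H1.unique Rel.zero

lemma vanish2 [IsNoetherianRing R] (k : ℕ) (hN : ∀ r ∈ J ^ k, ∀ x : N, r • x = 0)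
    (h : (localCohomology J 2).obj N) : h = 0 := by
  obtain ⟨t, f, H⟩ := Rel.exists_rel h
  obtain ⟨r, α, hα⟩ := key J t
  let d1 : (Res J t).complex.X 1 →ₗ[R] (Res J t).complex.X 0 := ((Res J t).complex.d 1 0).hom
  let d2 : (Res J t).complex.X 2 →ₗ[R] (Res J t).complex.X 1 := ((Res J t).complex.d 2 1).hom
  let Z : Submodule R (Fin r → R) := LinearMap.ker (d1 ∘ₗ α)
  let Z0 : Submodule R (Fin r → R) := ((LinearMap.ker f.hom).map d2).comap α
  have hZ : J ^ k • Z ≤ Z0 := by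
    rw [Submodule.smul_le]
    intro s hs z hz
    obtain ⟨y, hy⟩ := (ShortComplex.moduleCat_exact_iff _).1 ((Res J t).exact_succ 0) (α z) hz
    refine ⟨s • y, ?_, ?_⟩
    · change f.hom (s • y) = 0
      rw [map_smul]
      exact hN s hs _
    · rw [map_smul, map_smul]
      exact congrArg (fun x => s • x) hy
  obtain ⟨c, hc⟩ := Ideal.exists_pow_inf_eq_pow_smul J Z
  have hAR : J ^ (c + k) • ⊤ ⊓ Z ≤ Z0 := by
    rw [hc (c + k) (by omega), Nat.add_sub_cancel_left]
    exact le_trans (Submodule.smul_mono le_rfl inf_le_right) hZ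
  obtain ⟨U, hU, hU1⟩ := hα (c + k)
  have H1 := H.mapX _ U hU
  have h0 : U.f 2 ≫ f = 0 := by
    ext y
    obtain ⟨w, hw, hwy⟩ := hU1 ((Res J (t+(c+k))).complex.d 2 1 y)
    have hd : d2 (U.f 2 y) = α w := by
      rw [← hwy]
      exact congrArg (fun q => q.hom y) (U.comm 2 1)
    have hwZ : w ∈ Z := by
      change d1 (α w) = 0
      rw [← hd]
      exact congrArg (fun q => q.hom (U.f 2 y)) ((Res J t).complex.d_comp_d 2 1 0)
    obtain ⟨y0, hy0, hy1⟩ := hAR ⟨hw, hwZ⟩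
    have hz : d2 (U.f 2 y - y0) = 0 := by rw [map_sub, hd, hy1, sub_self]
    obtain ⟨v, hv⟩ := (ShortComplex.moduleCat_exact_iff _).1 ((Res J t).exact_succ 1)
      (U.f 2 y - y0) hz
    have h3 : f.hom (U.f 2 y - y0) = 0 := by
      rw [← hv]
      exact congrArg (fun q => q.hom v) H.cocycle
    rw [map_sub, sub_eq_zero] at h3
    exact h3.trans hy0
  rw [h0] at H1
  exact H1.unique Rel.zero

lemma pow_kill [IsLocalRing R] [IsNoetherianRing R] {L : Type u} [AddCommGroup L] [Module R L]
    (hL : IsFiniteLength R L) :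
    ∃ k : ℕ, ∀ r ∈ (IsLocalRing.maximalIdeal R) ^ k, ∀ x : L, r • x = 0 := by
  obtain ⟨h1, h2⟩ := isFiniteLength_iff_isNoetherian_isArtinian.1 hL
  let F : ℕ →o (Submodule R L)ᵒᵈ :=
    ⟨fun k => OrderDual.toDual ((IsLocalRing.maximalIdeal R) ^ k • (⊤ : Submodule R L)),
      fun i j hij => Submodule.smul_mono (Ideal.pow_le_pow_right hij) le_rfl⟩
  obtain ⟨k, hk⟩ := IsArtinian.monotone_stabilizes F
  have e : (IsLocalRing.maximalIdeal R) ^ k • (⊤ : Submodule R L) =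
    (IsLocalRing.maximalIdeal R) ^ (k+1) • (⊤ : Submodule R L) := hk (k+1) (by omega)
  have b : (IsLocalRing.maximalIdeal R) ^ k • (⊤ : Submodule R L) = ⊥ := by
    apply Submodule.eq_bot_of_le_smul_of_le_jacobson_bot (IsLocalRing.maximalIdeal R) _
      (IsNoetherian.noetherian _) _ (IsLocalRing.maximalIdeal_le_jacobson _)
    conv_lhs => rw [e]
    rw [pow_succ', Submodule.mul_smul]
  refine ⟨k, fun r hr x => ?_⟩
  have : r • x ∈ (IsLocalRing.maximalIdeal R) ^ k • (⊤ : Submodule R L) :=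
    Submodule.smul_mem_smul hr trivial
  rwa [b] at this

lemma ker_kill [IsLocalRing R] [IsNoetherianRing R] {D : Type u} [AddCommGroup D] [Module R D]
    [Module.Finite R D] (a : R) (k : ℕ)
    (hk : ∀ r ∈ (IsLocalRing.maximalIdeal R) ^ k,
      ∀ x : D ⧸ (Ideal.span {a} • ⊤ : Submodule R D), r • x = 0) :
    ∃ l : ℕ, ∀ r ∈ (IsLocalRing.maximalIdeal R) ^ l,
      ∀ x : LinearMap.ker (LinearMap.lsmul R D a), r • x = 0 := by
  have hrad : IsLocalRing.maximalIdeal R ≤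
      (Module.annihilator R (LinearMap.ker (LinearMap.lsmul R D a))).radical := by
    rw [Ideal.radical_eq_sInf]
    refine le_sInf ?_
    rintro p ⟨hp, hpp⟩
    let P : PrimeSpectrum R := ⟨p, hpp⟩
    have h1 : P ∈ Module.support R (LinearMap.ker (LinearMap.lsmul R D a)) := by
      rw [Module.support_eq_zeroLocus]; exact hp
    have h2 : P ∈ Module.support R D :=
      Module.support_subset_of_injective (Submodule.subtype _) (Submodule.subtype_injective _) h1
    have ha : a ∈ p := hp (by
      rw [Module.mem_annihilator]
      rintro ⟨x, hx⟩
      exact Subtype.ext hx)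
    have h3 : P ∈ Module.support R (D ⧸ (Ideal.span {a} • ⊤ : Submodule R D)) := by
      rw [Module.support_quotient]
      refine ⟨h2, ?_⟩
      rw [PrimeSpectrum.mem_zeroLocus]
      exact (Ideal.span_singleton_le_iff_mem _).2 ha
    rw [Module.support_eq_zeroLocus] at h3
    have h4 : (IsLocalRing.maximalIdeal R) ^ k ≤ p := fun r hr =>
      h3 (Module.mem_annihilator.2 (hk r hr))
    exact hpp.le_of_pow_le h4
  obtain ⟨l, hl⟩ := Ideal.exists_pow_le_of_le_radical_of_fg hrad
    (IsNoetherian.noetherian _)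
  exact ⟨l, fun r hr => Module.mem_annihilator.1 (hl hr)⟩

/-- The short complex attached to an exact pair of linear maps. -/
def SC {A B C : Type u} [AddCommGroup A] [AddCommGroup B] [AddCommGroup C]
    [Module R A] [Module R B] [Module R C] (f : A →ₗ[R] B) (g : B →ₗ[R] C)
    (h : Function.Exact f g) : ShortComplex (ModuleCat.{u} R) :=
  ShortComplex.mk (ModuleCat.ofHom f) (ModuleCat.ofHom g) (by
    ext x; exact h.apply_apply_eq_zero x)

lemma SC_exact {A B C : Type u} [AddCommGroup A] [AddCommGroup B] [AddCommGroup C]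
    [Module R A] [Module R B] [Module R C] (f : A →ₗ[R] B) (g : B →ₗ[R] C)
    (h : Function.Exact f g) (hf : Function.Injective f) (hg : Function.Surjective g) :
    (SC f g h).ShortExact where
  exact := (ShortComplex.moduleCat_exact_iff _).2 (fun x hx => (h x).1 hx)
  mono_f := (ModuleCat.mono_iff_injective _).2 hf
  epi_g := (ModuleCat.epi_iff_surjective _).2 hg

section D
variable [IsNoetherianRing R] {D : Type u} [AddCommGroup D] [Module R D] (J : Ideal R)
  (a : R) (k l : ℕ)

lemma comp_map {A B C : Type u} [AddCommGroup A] [AddCommGroup B] [AddCommGroup C]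
    [Module R A] [Module R B] [Module R C] (f : A →ₗ[R] B) (g : B →ₗ[R] C) (i : ℕ)
    (h : (localCohomology J i).obj (ModuleCat.of R A)) :
    (localCohomology J i).map (ModuleCat.ofHom (g ∘ₗ f)) h =
      (localCohomology J i).map (ModuleCat.ofHom g)
        ((localCohomology J i).map (ModuleCat.ofHom f) h) := by
  rw [ModuleCat.ofHom_comp, Functor.map_comp]; rfl

lemma seq1 : (SC (Submodule.subtype (LinearMap.ker (LinearMap.lsmul R D a)))
    (LinearMap.lsmul R D a).rangeRestrict (by
      intro x
      simp [Subtype.ext_iff])).ShortExact :=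
  SC_exact _ _ _ (Submodule.subtype_injective _) (LinearMap.surjective_rangeRestrict _)

lemma range_eq : LinearMap.range (LinearMap.lsmul R D a) =
    (Ideal.span {a} • ⊤ : Submodule R D) := by
  ext x
  rw [Submodule.ideal_span_singleton_smul, Submodule.mem_smul_pointwise_iff_exists]
  simp

lemma seq2 : (SC (Submodule.subtype (LinearMap.range (LinearMap.lsmul R D a)))
    (Submodule.mkQ (Ideal.span {a} • ⊤ : Submodule R D)) (by
      intro x
      rw [← range_eq]; simp)).ShortExact :=
  SC_exact _ _ _ (Submodule.subtype_injective _) (Submodule.mkQ_surjective _)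

lemma comp_eq : Submodule.subtype (LinearMap.range (LinearMap.lsmul R D a)) ∘ₗ
    (LinearMap.lsmul R D a).rangeRestrict = LinearMap.lsmul R D a := by
  ext x; rfl

lemma H1_div
    (hk : ∀ r ∈ J ^ k, ∀ x : D ⧸ (Ideal.span {a} • ⊤ : Submodule R D), r • x = 0)
    (hl : ∀ r ∈ J ^ l, ∀ x : LinearMap.ker (LinearMap.lsmul R D a), r • x = 0)
    (h : (localCohomology J 1).obj (ModuleCat.of R D)) : ∃ h', a • h' = h := by
  obtain ⟨b, hb⟩ := exact_mid (i := 0) (J := J) (seq2 (D := D) a) h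
    (vanish1 (N := ModuleCat.of R (D ⧸ (Ideal.span {a} • ⊤ : Submodule R D))) k hk _)
  obtain ⟨c, hc⟩ := surj_of_vanish (i := 1) (J := J) (seq1 (D := D) a)
    (fun z => vanish2 (N := ModuleCat.of R (LinearMap.ker (LinearMap.lsmul R D a))) l hl z) b
  refine ⟨c, ?_⟩
  rw [← map_lsmul (N := ModuleCat.of R D) a c]
  refine Eq.trans ?_ hb
  rw [← hc]
  refine Eq.trans ?_ (comp_map J _ _ 1 c)
  rw [comp_eq]

lemma H2_zero
    (hk : ∀ r ∈ J ^ k, ∀ x : D ⧸ (Ideal.span {a} • ⊤ : Submodule R D), r • x = 0)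
    (hl : ∀ r ∈ J ^ l, ∀ x : LinearMap.ker (LinearMap.lsmul R D a), r • x = 0)
    (ha : a ∈ J) (h : (localCohomology J 2).obj (ModuleCat.of R D)) : h = 0 := by
  have inj : ∀ c : (localCohomology J 2).obj (ModuleCat.of R D), a • c = 0 → c = 0 := by
    intro c hc
    rw [← map_lsmul (N := ModuleCat.of R D) a c] at hc
    have e : (localCohomology J 2).map
        (ModuleCat.ofHom (Submodule.subtype (LinearMap.range (LinearMap.lsmul R D a))))
        ((localCohomology J 2).map (ModuleCat.ofHom (LinearMap.lsmul R D a).rangeRestrict) c)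
        = 0 := by
      refine (comp_map J _ _ 2 c).symm.trans ?_
      rw [comp_eq]; exact hc
    have e2 := inj_of_vanish (i := 0) (J := J) (seq2 (D := D) a)
      (fun z => vanish1 (N := ModuleCat.of R (D ⧸ (Ideal.span {a} • ⊤ : Submodule R D))) k hk z)
      _ e
    obtain ⟨b, hb⟩ := exact_mid (i := 1) (J := J) (seq1 (D := D) a) c e2
    have hb0 : b = 0 :=
      vanish2 (N := ModuleCat.of R (LinearMap.ker (LinearMap.lsmul R D a))) l hl b
    rw [← hb, hb0, map_zero]
    rfl
  obtain ⟨t, ht⟩ := torsion (N := ModuleCat.of R D) a ha h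
  induction t with
  | zero => simpa using ht
  | succ t ih =>
    apply ih
    apply inj
    rw [smul_smul, ← pow_succ']
    exact ht
end D

theorem main [IsLocalRing R] [IsNoetherianRing R]
    {M S : Type u} [AddCommGroup M] [Module R M] [AddCommGroup S] [Module R S]
    [Module.Finite R S] (ι : M →ₗ[R] S) (hι : Function.Injective ι)
    (a : R) (ham : a ∈ IsLocalRing.maximalIdeal R)
    (hD : IsFiniteLength R ((S ⧸ LinearMap.range ι) ⧸
      (Ideal.span {a} • ⊤ : Submodule R (S ⧸ LinearMap.range ι))))
    (haH2S : ∀ s : ((localCohomology (IsLocalRing.maximalIdeal R) 2).obj (ModuleCat.of R S)),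
      a • s = 0) :
    Nonempty
      ((((localCohomology (IsLocalRing.maximalIdeal R) 2).obj (ModuleCat.of R M)) ⧸
          (Ideal.span {a} • ⊤ :
            Submodule R ((localCohomology (IsLocalRing.maximalIdeal R) 2).obj
              (ModuleCat.of R M)))) ≃ₗ[R]
        ((localCohomology (IsLocalRing.maximalIdeal R) 2).obj (ModuleCat.of R S))) := by
  obtain ⟨k, hk⟩ := pow_kill hD
  obtain ⟨l, hl⟩ := ker_kill a k hk
  have hT := SC_exact ι (LinearMap.range ι).mkQ (by intro x; simp) hι (Submodule.mkQ_surjective _)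
  let φ : ((localCohomology (IsLocalRing.maximalIdeal R) 2).obj (ModuleCat.of R M)) →ₗ[R]
    ((localCohomology (IsLocalRing.maximalIdeal R) 2).obj (ModuleCat.of R S)) :=
    ((localCohomology (IsLocalRing.maximalIdeal R) 2).map (ModuleCat.ofHom ι)).hom
  have hsurj : Function.Surjective φ := by
    intro s
    exact exact_mid (i := 1) (J := IsLocalRing.maximalIdeal R) hT s
      (H2_zero (IsLocalRing.maximalIdeal R) a k l hk hl ham _)
  have hker : (Ideal.span {a} • ⊤ : Submodule R
      ((localCohomology (IsLocalRing.maximalIdeal R) 2).obj (ModuleCat.of R M))) =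
      LinearMap.ker φ := by
    rw [Submodule.ideal_span_singleton_smul]
    ext x
    rw [Submodule.mem_smul_pointwise_iff_exists, LinearMap.mem_ker]
    constructor
    · rintro ⟨y, -, rfl⟩
      rw [map_smul]; exact haH2S _
    · intro hx
      obtain ⟨y, hy⟩ := ker_divisible (i := 0) (J := IsLocalRing.maximalIdeal R) hT a
        (fun c => by
          obtain ⟨c', hc'⟩ := H1_div (IsLocalRing.maximalIdeal R) a k l hk hl c
          first | exact ⟨c', hc'⟩ | exact ⟨c', hc'.symm⟩) x hx
      exact ⟨y, trivial, hy.symm⟩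
  exact ⟨(Submodule.quotEquivOfEq _ _ hker).trans (φ.quotKerEquivOfSurjective hsurj)⟩

end LC

end

open Paper IsLocalRing

/-- If `M` is unmixed of dimension 3 and depth 2, not generalized
Cohen-Macaulay, `S` an `S_2`-ification of `M`, `D = S/M`, and `x ∈ m` a parameter element of
`M` with `D/xD` of finite length and `x·H^2_m(S) = 0`, then
`H^2_m(M)/x·H^2_m(M) ≅ H^2_m(S)`. -/
theorem stmt15 (R : Type u) [CommRing R] [IsLocalRing R] [IsNoetherianRing R]
    (hCM : IsQuotientOfCMLocalRing R)
    (M : Type u) [AddCommGroup M] [Module R M] [Module.Finite R M]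
    (hum : IsUnmixed R M) (hdim : mdim R M = 3) (hdepth : depth R M = 2)
    (hngcm : ¬ IsGenCM R M 3)
    (S : Type u) [AddCommGroup S] [Module R S]
    (ι : M →ₗ[R] S) (hS : IsS2ification R M S ι)
    (a : R) (ham : a ∈ maximalIdeal R) (hpe : IsParamElement R M 3 a)
    (hD : IsFiniteLength R ((S ⧸ LinearMap.range ι) ⧸
      (Ideal.span {a} • ⊤ : Submodule R (S ⧸ LinearMap.range ι))))
    (haH2S : ∀ s : ((localCohomology (maximalIdeal R) 2).obj (ModuleCat.of R S)), a • s = 0) :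
    Nonempty
      ((((localCohomology (maximalIdeal R) 2).obj (ModuleCat.of R M)) ⧸
          (Ideal.span {a} • ⊤ :
            Submodule R ((localCohomology (maximalIdeal R) 2).obj (ModuleCat.of R M)))) ≃ₗ[R]
        ((localCohomology (maximalIdeal R) 2).obj (ModuleCat.of R S))) := by
  obtain ⟨hι, hfin, -, -⟩ := hS
  exact LC.main ι hι a ham hD haH2S
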